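/- Let q be a prime power and n ≥ 1, and let k(n,q) denote the number of equivalence classes of GL(n,F_q) under the congruence relation a ~ b iff b = x a xᵀ for some x ∈ GL(n,F_q) (equivalently, the number of conjugacy classes of ⟨GL(n,q),τ⟩ contained in the coset GL(n,q)τ). If q is even then k(n,q) ≤ 28·q^{⌊n/2⌋}, and if q is odd then k(n,q) ≤ 23·q^{⌊n/2⌋}. -/

import Mathlib

open Matrix

/-- The congruence relation on `GL(n,F)`: `a ~ b` iff `b = x a xᵀ` for some `x ∈ GL(n,F)`. -/
def congRel {n : ℕ} {F : Type} [Field F] (a b : GL (Fin n) F) : Prop :=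
  ∃ x : GL (Fin n) F, b.val = x.val * a.val * x.valᵀ

section QuotientTorsion

open Polynomial

variable {F : Type} [Field F]

lemma natCard_quotient_span_singleton [Fintype F] {g : F[X]} (hg : g ≠ 0) :
    Nat.card (F[X] ⧸ Submodule.span F[X] {g}) = Fintype.card F ^ g.natDegree := by
  have hfin : Module.Finite F (F[X] ⧸ Ideal.span {g}) := by
    have : Module.Finite F (AdjoinRoot g) := (AdjoinRoot.powerBasis hg).finite
    exact this
  have h := Module.natCard_eq_pow_finrank (K := F) (V := F[X] ⧸ Ideal.span {g})
  rw [finrank_quotient_span_eq_natDegree, Nat.card_eq_fintype_card (α := F)] at h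
  exact h

lemma smul_quotient_span_eq_zero_iff {R : Type*} [CommRing R] (a f g : R) :
    f • (Submodule.Quotient.mk a : R ⧸ Submodule.span R {g}) = 0 ↔ g ∣ f * a := by
  rw [← Submodule.Quotient.mk_smul, Submodule.Quotient.mk_eq_zero, Submodule.mem_span_singleton,
    smul_eq_mul]
  exact ⟨fun ⟨c, hc⟩ => ⟨c, by rw [← hc, smul_eq_mul, mul_comm]⟩,
    fun ⟨c, hc⟩ => ⟨c, by rw [hc, smul_eq_mul, mul_comm]⟩⟩

lemma natCard_torsion_quotient_pow_self [Fintype F] {p : F[X]} (hp : p ≠ 0) (k e : ℕ) :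
    Nat.card {m : F[X] ⧸ Submodule.span F[X] {p ^ e} // p ^ k • m = 0} =
      Fintype.card F ^ (p.natDegree * min k e) := by
  rcases le_total e k with hek | hke
  · rw [min_eq_right hek, mul_comm, ← natDegree_pow,
      ← natCard_quotient_span_singleton (pow_ne_zero e hp)]
    refine Nat.card_congr (Equiv.subtypeUnivEquiv fun m => ?_)
    obtain ⟨a, rfl⟩ := Submodule.Quotient.mk_surjective _ m
    rw [smul_quotient_span_eq_zero_iff]
    exact (pow_dvd_pow p hek).mul_right a
  · rw [min_eq_left hke, mul_comm, ← natDegree_pow,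
      ← natCard_quotient_span_singleton (pow_ne_zero k hp)]
    let φ : F[X] →ₗ[F[X]] (F[X] ⧸ Submodule.span F[X] {p ^ e}) :=
      LinearMap.toSpanSingleton F[X] _ (Submodule.Quotient.mk (p ^ (e - k)))
    have hpe : p ^ e = p ^ (e - k) * p ^ k := by rw [← pow_add, Nat.sub_add_cancel hke]
    have hker : LinearMap.ker φ = Submodule.span F[X] {p ^ k} := by
      ext r
      rw [LinearMap.mem_ker, LinearMap.toSpanSingleton_apply, smul_quotient_span_eq_zero_iff,
        ← Ideal.span, Ideal.mem_span_singleton, hpe, mul_comm r]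
      exact mul_dvd_mul_iff_left (pow_ne_zero _ hp)
    have hrange : ∀ m, p ^ k • m = 0 ↔ m ∈ LinearMap.range φ := by
      intro m
      obtain ⟨a, rfl⟩ := Submodule.Quotient.mk_surjective _ m
      rw [smul_quotient_span_eq_zero_iff]
      constructor
      · intro h
        rw [hpe, mul_comm] at h
        obtain ⟨c, rfl⟩ := (mul_dvd_mul_iff_left (pow_ne_zero k hp)).mp h
        exact ⟨c, by rw [LinearMap.toSpanSingleton_apply, ← Submodule.Quotient.mk_smul,
          smul_eq_mul, mul_comm]⟩
      · rintro ⟨c, hc⟩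
        rw [← smul_quotient_span_eq_zero_iff, ← hc, LinearMap.toSpanSingleton_apply, smul_comm,
          (smul_quotient_span_eq_zero_iff _ _ _).mpr, smul_zero]
        rw [hpe, mul_comm]
    refine Nat.card_congr ((Equiv.subtypeEquivRight hrange).trans ?_)
    exact (φ.quotKerEquivRange.symm.toEquiv).trans (Submodule.quotEquivOfEq _ _ hker).toEquiv

lemma natCard_torsion_quotient_of_isCoprime {f g : F[X]} (h : IsCoprime g f) :
    Nat.card {m : F[X] ⧸ Submodule.span F[X] {g} // f • m = 0} = 1 := by
  rw [Nat.card_eq_one_iff_unique]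
  refine ⟨⟨fun a b => ?_⟩, ⟨⟨0, smul_zero f⟩⟩⟩
  have key : ∀ m : F[X] ⧸ Submodule.span F[X] {g}, f • m = 0 → m = 0 := by
    intro m hm
    obtain ⟨a, rfl⟩ := Submodule.Quotient.mk_surjective _ m
    rw [smul_quotient_span_eq_zero_iff] at hm
    have := (smul_quotient_span_eq_zero_iff a 1 g).mpr (by simpa using h.dvd_of_dvd_mul_left hm)
    rwa [one_smul] at this
  exact Subtype.ext ((key _ a.2).trans (key _ b.2).symm)

end QuotientTorsion

section ElementaryDivisors

open Polynomial Module

variable {F : Type} [Field F] {n : ℕ}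

/-- The number of vectors annihilated by `f(A)`. -/
noncomputable def kerCard (A : Matrix (Fin n) (Fin n) F) (f : F[X]) : ℕ :=
  Nat.card {v : Fin n → F // (aeval A f) *ᵥ v = 0}

/-- The pairs `(p i, e i)` are elementary divisors of `A`, possibly with some trivial ones
(with `e i = 0`). -/
def HasElementaryDivisors (A : Matrix (Fin n) (Fin n) F) {ι : Type} (p : ι → F[X])
    (e : ι → ℕ) : Prop :=
  (∀ i, (p i).Monic ∧ Irreducible (p i)) ∧
    Nonempty (AEval' (Matrix.toLin' A) ≃ₗ[F[X]]
      Π i, F[X] ⧸ Submodule.span F[X] {p i ^ e i})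

lemma exists_hasElementaryDivisors (A : Matrix (Fin n) (Fin n) F) :
    ∃ (ι : Type) (_ : Fintype ι) (p : ι → F[X]) (e : ι → ℕ), HasElementaryDivisors A p e := by
  classical
  obtain ⟨ι, hι, p, hp, e, ⟨φ⟩⟩ := Module.equiv_directSum_of_isTorsion
    (AEval.isTorsion_of_finiteDimensional F (Fin n → F) (Matrix.toLin' A))
  refine ⟨ι, hι, fun i => normalize (p i), e, fun i => ⟨monic_normalize (hp i).ne_zero,
    (associated_normalize (p i)).irreducible (hp i)⟩, ⟨φ.trans
      ((DirectSum.linearEquivFunOnFintype F[X] ι _).trans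
        (LinearEquiv.piCongrRight fun i => Submodule.quotEquivOfEq _ _ ?_))⟩⟩
  rw [← Ideal.span, ← Ideal.span, Ideal.span_singleton_eq_span_singleton]
  exact (associated_normalize (p i)).pow_pow

lemma aeval_toLin' (A : Matrix (Fin n) (Fin n) F) (f : F[X]) :
    aeval (Matrix.toLin' A) f = Matrix.toLin' (aeval A f) :=
  aeval_algHom_apply (Matrix.toLinAlgEquiv' (R := F) (n := Fin n)) A f

lemma kerCard_eq_prod {A : Matrix (Fin n) (Fin n) F} {ι : Type} [Fintype ι] {p : ι → F[X]}
    {e : ι → ℕ} (h : HasElementaryDivisors A p e) (f : F[X]) :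
    kerCard A f =
      ∏ i, Nat.card {m : F[X] ⧸ Submodule.span F[X] {p i ^ e i} // f • m = 0} := by
  obtain ⟨-, ⟨φ⟩⟩ := h
  rw [← Nat.card_pi, kerCard]
  refine Nat.card_congr (Equiv.trans ?_
    (Equiv.subtypePiEquivPi (p := fun i (m : F[X] ⧸ Submodule.span F[X] {p i ^ e i}) =>
      f • m = 0)))
  refine Equiv.subtypeEquiv
    ((AEval'.of (Matrix.toLin' A)).toEquiv.trans φ.toEquiv) fun v => ?_
  have h1 : (aeval A f) *ᵥ v = 0 ↔ f • AEval'.of (Matrix.toLin' A) v = 0 := by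
    rw [AEval'.of, ← AEval.of_aeval_smul, LinearEquiv.map_eq_zero_iff, Module.End.smul_def,
      aeval_toLin', Matrix.toLin'_apply]
  rw [h1, ← φ.map_eq_zero_iff, map_smul]
  exact funext_iff

lemma kerCard_pow [Fintype F] {A : Matrix (Fin n) (Fin n) F} {ι : Type} [Fintype ι]
    {p : ι → F[X]} {e : ι → ℕ} (h : HasElementaryDivisors A p e) {r : F[X]} (hr : r.Monic)
    (hri : Irreducible r) (k : ℕ) [DecidablePred fun i => p i = r] :
    kerCard A (r ^ k) =
      Fintype.card F ^ (r.natDegree * ∑ i with p i = r, min k (e i)) := by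
  rw [kerCard_eq_prod h, Finset.mul_sum, ← Finset.prod_pow_eq_pow_sum, Finset.prod_filter]
  refine Finset.prod_congr rfl fun i _ => ?_
  split_ifs with hi
  · rw [hi]
    exact natCard_torsion_quotient_pow_self hri.ne_zero k (e i)
  · refine natCard_torsion_quotient_of_isCoprime (IsCoprime.pow ?_)
    rw [(h.1 i).2.coprime_iff_not_dvd]
    exact fun hd => hi (eq_of_monic_of_associated (h.1 i).1 hr
      ((h.1 i).2.associated_of_dvd hri hd))

end ElementaryDivisors

section Reciprocal

open Polynomial

variable {F : Type} [Field F]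

/-- The reciprocal polynomial, scaled to be monic when `f` has nonzero constant term. -/
noncomputable def monicReverse (f : F[X]) : F[X] := C (f.coeff 0)⁻¹ * f.reverse

lemma coeff_monicReverse {f : F[X]} {i : ℕ} (hi : i ≤ f.natDegree) :
    (monicReverse f).coeff i = (f.coeff 0)⁻¹ * f.coeff (f.natDegree - i) := by
  rw [monicReverse, coeff_C_mul, coeff_reverse, revAt_le hi]

lemma monicReverse_mul (f g : F[X]) : monicReverse (f * g) = monicReverse f * monicReverse g := by
  rw [monicReverse, monicReverse, monicReverse, reverse_mul_of_domain, mul_coeff_zero, mul_inv,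
    C_mul]
  ring

lemma monicReverse_one : monicReverse (1 : F[X]) = 1 := by
  have h := reverse_C (1 : F)
  rw [C_1] at h
  rw [monicReverse, h, coeff_one_zero, inv_one, C_1, one_mul]

lemma natDegree_monicReverse {f : F[X]} (hf : f.coeff 0 ≠ 0) :
    (monicReverse f).natDegree = f.natDegree := by
  rw [monicReverse, natDegree_C_mul (inv_ne_zero hf), reverse_natDegree,
    natTrailingDegree_eq_zero.mpr (Or.inr hf), Nat.sub_zero]

lemma monic_monicReverse {f : F[X]} (hf : f.coeff 0 ≠ 0) : (monicReverse f).Monic := by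
  rw [Monic, leadingCoeff, natDegree_monicReverse hf, coeff_monicReverse le_rfl, Nat.sub_self,
    inv_mul_cancel₀ hf]

lemma coeff_zero_monicReverse {f : F[X]} (hm : f.Monic) :
    (monicReverse f).coeff 0 = (f.coeff 0)⁻¹ := by
  rw [coeff_monicReverse (Nat.zero_le _), Nat.sub_zero, hm.coeff_natDegree, mul_one]

lemma monicReverse_monicReverse {f : F[X]} (hm : f.Monic) (hf : f.coeff 0 ≠ 0) :
    monicReverse (monicReverse f) = f := by
  have hd := natDegree_monicReverse hf
  have h0 : (monicReverse f).coeff 0 ≠ 0 := by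
    rw [coeff_zero_monicReverse hm]
    exact inv_ne_zero hf
  ext i
  rcases le_or_gt i f.natDegree with hi | hi
  · rw [coeff_monicReverse (hd.symm ▸ hi), coeff_zero_monicReverse hm, hd,
      coeff_monicReverse (Nat.sub_le _ _), Nat.sub_sub_self hi, inv_inv, mul_inv_cancel_left₀ hf]
  · rw [coeff_eq_zero_of_natDegree_lt hi, coeff_eq_zero_of_natDegree_lt]
    rwa [natDegree_monicReverse h0, hd]

lemma irreducible_monicReverse {f : F[X]} (hm : f.Monic) (hf : f.coeff 0 ≠ 0)
    (hi : Irreducible f) : Irreducible (monicReverse f) := by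
  have h0 : (monicReverse f).coeff 0 ≠ 0 := by
    rw [coeff_zero_monicReverse hm]
    exact inv_ne_zero hf
  have unit_iff : ∀ g : F[X], g.coeff 0 ≠ 0 → (IsUnit (monicReverse g) ↔ IsUnit g) := by
    intro g hg
    have hg0 : g ≠ 0 := fun h => hg (by rw [h, coeff_zero])
    rw [isUnit_iff_degree_eq_zero, isUnit_iff_degree_eq_zero,
      degree_eq_natDegree (monic_monicReverse hg).ne_zero, degree_eq_natDegree hg0,
      natDegree_monicReverse hg]
  refine ⟨fun h => hi.not_isUnit ((unit_iff f hf).mp h), fun a b hab => ?_⟩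
  have hab0 : a.coeff 0 ≠ 0 ∧ b.coeff 0 ≠ 0 := by
    rw [hab, mul_coeff_zero] at h0
    exact ⟨left_ne_zero_of_mul h0, right_ne_zero_of_mul h0⟩
  rw [← unit_iff a hab0.1, ← unit_iff b hab0.2]
  refine hi.isUnit_or_isUnit ?_
  rw [← monicReverse_mul, ← hab, monicReverse_monicReverse hm hf]

lemma monicReverse_pow (f : F[X]) (k : ℕ) : monicReverse (f ^ k) = monicReverse f ^ k := by
  induction k with
  | zero => rw [pow_zero, pow_zero, monicReverse_one]
  | succ k ih => rw [pow_succ, pow_succ, monicReverse_mul, ih]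

lemma monicReverse_prod {ι : Type*} (s : Finset ι) (f : ι → F[X]) :
    monicReverse (∏ i ∈ s, f i) = ∏ i ∈ s, monicReverse (f i) := by
  classical
  induction s using Finset.induction_on with
  | empty => rw [Finset.prod_empty, Finset.prod_empty, monicReverse_one]
  | insert i s hi ih => rw [Finset.prod_insert hi, Finset.prod_insert hi, monicReverse_mul, ih]

variable {n : ℕ}

lemma aeval_reflect {S : Type*} [Ring S] [Algebra F S] {u v : S} (huv : u * v = 1)
    (N : ℕ) (f : F[X]) (hf : f.natDegree ≤ N) :
    aeval u (f.reflect N) = u ^ N * aeval v f := by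
  refine induction_with_natDegree_le (fun f => aeval u (f.reflect N) = u ^ N * aeval v f) N
    ?_ ?_ ?_ f hf
  · simp
  · intro k r _ hk
    rw [reflect_C_mul_X_pow, revAt_le hk]
    have huk : u ^ k * v ^ k = 1 := by
      induction k with
      | zero => simp
      | succ k ih =>
        rw [pow_succ, pow_succ', mul_assoc, ← mul_assoc u, huv, one_mul, ih (by omega)]
    simp only [map_mul, aeval_C, map_pow, aeval_X]
    rw [← mul_assoc, ← Algebra.commutes r (u ^ N), mul_assoc]
    conv_rhs => rw [← Nat.sub_add_cancel hk, pow_add, mul_assoc (u ^ (N - k)), huk, mul_one]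
  · intro f g _ _ h1 h2
    rw [reflect_add, map_add, map_add, h1, h2, mul_add]

lemma mul_aeval_of_semiconjBy {S : Type*} [Ring S] [Algebra F S] {a y z : S}
    (h : SemiconjBy a y z) (f : F[X]) : a * aeval y f = aeval z f * a := by
  induction f using Polynomial.induction_on' with
  | add f g hf hg => rw [map_add, map_add, mul_add, add_mul, hf, hg]
  | monomial k r =>
    rw [aeval_monomial, aeval_monomial, ← mul_assoc, ← Algebra.commutes r a, mul_assoc,
      (h.pow_right k).eq, mul_assoc]

lemma aeval_transpose (x : Matrix (Fin n) (Fin n) F) (f : F[X]) :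
    aeval xᵀ f = (aeval x f)ᵀ := by
  induction f using Polynomial.induction_on' with
  | add f g hf hg => rw [map_add, map_add, Matrix.transpose_add, hf, hg]
  | monomial k r =>
    rw [aeval_monomial, aeval_monomial, ← Algebra.smul_def, ← Algebra.smul_def,
      Matrix.transpose_smul, Matrix.transpose_pow]

lemma kerCard_congr {A B : Matrix (Fin n) (Fin n) F} {f g : F[X]}
    (h : (aeval A f).rank = (aeval B g).rank) : kerCard A f = kerCard B g := by
  have key : ∀ M : Matrix (Fin n) (Fin n) F,
      M.rank + Module.finrank F (LinearMap.ker M.mulVecLin) = n := fun M => by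
    have := LinearMap.finrank_range_add_finrank_ker M.mulVecLin
    rwa [Module.finrank_fin_fun] at this
  have h2 : Module.finrank F (LinearMap.ker (aeval A f).mulVecLin) =
      Module.finrank F (LinearMap.ker (aeval B g).mulVecLin) := by
    have := key (aeval A f)
    have := key (aeval B g)
    omega
  exact Nat.card_congr (LinearEquiv.ofFinrankEq _ _ h2).toEquiv

/-- If `x` preserves a nondegenerate bilinear form, then `x` is similar to the inverse of its
transpose, so that its kernel cardinalities are invariant under taking reciprocals. -/
lemma kerCard_monicReverse {x a : GL (Fin n) F} (h : x.val * a.val * x.valᵀ = a.val)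
    {f : F[X]} (hf : f.coeff 0 ≠ 0) :
    kerCard x.val (monicReverse f) = kerCard x.val f := by
  refine kerCard_congr ?_
  have hu : ∀ u : GL (Fin n) F, IsUnit u.val.det :=
    fun u => (Matrix.isUnit_iff_isUnit_det _).mp u.isUnit
  have hsemi : SemiconjBy a.val x.valᵀ (x⁻¹).val := by
    have := congrArg ((x⁻¹).val * ·) h
    simp only [← mul_assoc, Units.inv_mul, one_mul] at this
    exact this
  have hrank : (aeval (x⁻¹).val f).rank = (aeval x.val f).rank := by
    rw [← Matrix.rank_transpose (aeval x.val f), ← aeval_transpose,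
      ← Matrix.rank_mul_eq_left_of_isUnit_det a.val _ (hu a), ← mul_aeval_of_semiconjBy hsemi,
      Matrix.rank_mul_eq_right_of_isUnit_det a.val _ (hu a)]
  have hrev : aeval x.val (monicReverse f) =
      algebraMap F _ (f.coeff 0)⁻¹ * (x.val ^ f.natDegree * aeval (x⁻¹).val f) := by
    rw [monicReverse, map_mul, aeval_C, reverse, aeval_reflect x.mul_inv _ f le_rfl]
  rw [hrev, ← hrank, Matrix.rank_mul_eq_right_of_isUnit_det,
    Matrix.rank_mul_eq_right_of_isUnit_det]
  · rw [Matrix.det_pow]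
    exact (hu x).pow _
  · exact (Matrix.isUnit_iff_isUnit_det _).mp
      ((IsUnit.mk0 _ (inv_ne_zero hf)).map (algebraMap F (Matrix (Fin n) (Fin n) F)))

end Reciprocal

section Invariants

open Polynomial Module

variable {F : Type} [Field F] {n : ℕ}

lemma sum_mul_natDegree [Fintype F] {A : Matrix (Fin n) (Fin n) F} {ι : Type} [Fintype ι]
    {p : ι → F[X]} {e : ι → ℕ} (h : HasElementaryDivisors A p e) :
    ∑ i, e i * (p i).natDegree = n := by
  have h1 := kerCard_eq_prod h 0
  have h2 : kerCard A 0 = Fintype.card F ^ n := by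
    rw [kerCard, Nat.card_congr (Equiv.subtypeUnivEquiv fun v => by
      rw [map_zero, Matrix.zero_mulVec])]
    simp
  have h3 : ∀ i, Nat.card {m : F[X] ⧸ Submodule.span F[X] {p i ^ e i} // (0 : F[X]) • m = 0} =
      Fintype.card F ^ (e i * (p i).natDegree) := by
    intro i
    rw [Nat.card_congr (Equiv.subtypeUnivEquiv fun v => zero_smul _ v),
      natCard_quotient_span_singleton (pow_ne_zero _ (h.1 i).2.ne_zero), natDegree_pow]
  rw [h2, Finset.prod_congr rfl fun i _ => h3 i, Finset.prod_pow_eq_pow_sum] at h1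
  exact (Nat.pow_right_injective Fintype.one_lt_card h1).symm

lemma exponent_le [Fintype F] {A : Matrix (Fin n) (Fin n) F} {ι : Type} [Fintype ι]
    {p : ι → F[X]} {e : ι → ℕ} (h : HasElementaryDivisors A p e) (i : ι) : e i ≤ n := by
  have h1 := sum_mul_natDegree h
  have h2 : e i * (p i).natDegree ≤ _ := Finset.single_le_sum (f := fun i => e i * (p i).natDegree)
    (fun _ _ => Nat.zero_le _) (Finset.mem_univ i)
  have h3 : e i * 1 ≤ e i * (p i).natDegree := Nat.mul_le_mul_left _ (h.1 i).2.natDegree_pos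
  omega

lemma coeff_zero_ne_zero [Fintype F] {x : GL (Fin n) F} {ι : Type} [Fintype ι]
    {p : ι → F[X]} {e : ι → ℕ} (h : HasElementaryDivisors x.val p e) {i : ι} (hi : 0 < e i) :
    (p i).coeff 0 ≠ 0 := by
  classical
  intro h0
  have hX : p i = X := (eq_of_monic_of_associated monic_X (h.1 i).1
    (irreducible_X.associated_of_dvd (h.1 i).2 (X_dvd_iff.mpr h0))).symm
  have h1 := kerCard_pow h monic_X irreducible_X 1
  have h2 : kerCard x.val (X ^ 1) = 1 := by
    rw [kerCard, Nat.card_eq_one_iff_unique]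
    have key : ∀ v, (aeval x.val (X ^ 1 : F[X])) *ᵥ v = 0 → v = 0 := by
      intro v hv
      rw [pow_one, aeval_X] at hv
      have := congrArg ((x⁻¹).val *ᵥ ·) hv
      simpa [Matrix.mulVec_mulVec] using this
    exact ⟨⟨fun a b => Subtype.ext ((key _ a.2).trans (key _ b.2).symm)⟩,
      ⟨⟨0, Matrix.mulVec_zero _⟩⟩⟩
  rw [h2, natDegree_X, one_mul, eq_comm, Nat.pow_eq_one] at h1
  have h3 := h1.resolve_left Fintype.one_lt_card.ne'
  rw [Finset.sum_eq_zero_iff] at h3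
  have := h3 i (by simpa using hX)
  omega

/-- For a function preserved by a nondegenerate form, the multiplicity of an elementary divisor
`r ^ k` agrees with that of its reciprocal. -/
lemma multiplicity_monicReverse [Fintype F] {x a : GL (Fin n) F}
    (hxa : x.val * a.val * x.valᵀ = a.val) {ι : Type} [Fintype ι] {p : ι → F[X]} {e : ι → ℕ}
    (h : HasElementaryDivisors x.val p e) {r : F[X]} (hr : r.Monic) (hri : Irreducible r)
    (hr0 : r.coeff 0 ≠ 0) {k : ℕ} (hk : 0 < k) [DecidableEq F[X]] :
    ∑ i with p i = r, (if e i = k then 1 else 0) =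
      ∑ i with p i = monicReverse r, (if e i = k then 1 else 0) := by
  have hS : ∀ k, ∑ i with p i = r, min k (e i) = ∑ i with p i = monicReverse r, min k (e i) := by
    intro k
    have h0 : (r ^ k).coeff 0 ≠ 0 := by
      rw [coeff_zero_eq_eval_zero, eval_pow, ← coeff_zero_eq_eval_zero]
      exact pow_ne_zero k hr0
    have h1 := kerCard_monicReverse hxa h0
    rw [monicReverse_pow, kerCard_pow h (monic_monicReverse hr0)
      (irreducible_monicReverse hr hr0 hri), kerCard_pow h hr hri,
      natDegree_monicReverse hr0] at h1
    exact (Nat.eq_of_mul_eq_mul_left hri.natDegree_pos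
      (Nat.pow_right_injective Fintype.one_lt_card h1)).symm
  have key : ∀ s : Finset ι, 2 * ∑ i ∈ s, min k (e i) =
      ∑ i ∈ s, min (k - 1) (e i) + ∑ i ∈ s, min (k + 1) (e i) +
        ∑ i ∈ s, (if e i = k then 1 else 0) := by
    intro s
    rw [Finset.mul_sum, ← Finset.sum_add_distrib, ← Finset.sum_add_distrib]
    refine Finset.sum_congr rfl fun i _ => ?_
    split_ifs <;> omega
  have h1 := key {i | p i = r}
  have h2 := key {i | p i = monicReverse r}
  have := hS k
  have := hS (k - 1)
  have := hS (k + 1)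
  omega

lemma monicReverse_prod_filter [Fintype F] {x a : GL (Fin n) F}
    (hxa : x.val * a.val * x.valᵀ = a.val) {ι : Type} [Fintype ι] {p : ι → F[X]} {e : ι → ℕ}
    (h : HasElementaryDivisors x.val p e) {k : ℕ} (hk : 0 < k) :
    monicReverse (∏ i with e i = k, p i) = ∏ i with e i = k, p i := by
  classical
  rw [monicReverse_prod]
  have h0 : ∀ i, e i = k → (p i).coeff 0 ≠ 0 := fun i hi => coeff_zero_ne_zero h (hi ▸ hk)
  have hcount : ∀ r : F[X], (Finset.univ.filter fun i => e i = k ∧ p i = r).card =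
      ∑ i with p i = r, (if e i = k then 1 else 0) := by
    intro r
    rw [Finset.card_filter, Finset.sum_filter]
    exact Finset.sum_congr rfl fun i _ => by split_ifs <;> simp_all
  suffices hms : (Finset.univ.filter fun i => e i = k).val.map (fun i => monicReverse (p i)) =
      (Finset.univ.filter fun i => e i = k).val.map p by
    rw [Finset.prod, Finset.prod, hms]
  ext r
  rw [Multiset.count_map, Multiset.count_map, ← Finset.filter_val, ← Finset.filter_val,
    Finset.card_val, Finset.card_val, Finset.filter_filter, Finset.filter_filter]
  by_cases hr : r.Monic ∧ Irreducible r ∧ r.coeff 0 ≠ 0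
  · obtain ⟨hm, hi, hr0⟩ := hr
    have h2 := multiplicity_monicReverse hxa h hm hi hr0 hk
    rw [← hcount, ← hcount] at h2
    refine (Eq.trans (congrArg Finset.card (Finset.filter_congr fun i _ => ?_)) h2.symm).trans
      (congrArg Finset.card (Finset.filter_congr fun i _ => ?_))
    · refine and_congr_right fun hik => ⟨fun hh => ?_, fun hh => ?_⟩
      · rw [hh, monicReverse_monicReverse (h.1 i).1 (h0 i hik)]
      · rw [hh, monicReverse_monicReverse hm hr0]
    · rw [eq_comm (a := r)]
  · rw [Finset.filter_false_of_mem, Finset.filter_false_of_mem]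
    · rintro i - ⟨hik, rfl⟩
      exact hr ⟨(h.1 i).1, (h.1 i).2, h0 i hik⟩
    · rintro i - ⟨hik, rfl⟩
      refine hr ⟨monic_monicReverse (h0 i hik),
        irreducible_monicReverse (h.1 i).1 (h0 i hik) (h.1 i).2, ?_⟩
      rw [coeff_zero_monicReverse (h.1 i).1]
      exact inv_ne_zero (h0 i hik)

lemma multiset_eq_of_prod_eq {s t : Multiset F[X]} (hs : ∀ r ∈ s, r.Monic ∧ Irreducible r)
    (ht : ∀ r ∈ t, r.Monic ∧ Irreducible r) (h : s.prod = t.prod) : s = t := by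
  have hrel := UniqueFactorizationMonoid.factors_unique (fun r hr => (hs r hr).2)
    (fun r hr => (ht r hr).2) (Associated.of_eq h)
  rw [← Multiset.rel_eq]
  exact hrel.mono fun a ha b hb hab => eq_of_monic_of_associated (hs a ha).1 (ht b hb).1 hab

/-- Discarding the trivial factors of a product of modules. -/
noncomputable def piSubtypeLinearEquiv {R ι : Type*} [Ring R] (N : ι → Type*)
    [∀ i, AddCommGroup (N i)] [∀ i, Module R (N i)] (s : ι → Prop)
    (h : ∀ i, ¬ s i → Subsingleton (N i)) : (Π i, N i) ≃ₗ[R] Π i : {i // s i}, N i.1 :=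
  LinearEquiv.ofBijective (LinearMap.pi fun i : {i // s i} => LinearMap.proj i.1) (by
    classical
    constructor
    · intro f g hfg
      funext i
      by_cases hi : s i
      · exact congrFun hfg ⟨i, hi⟩
      · have := h i hi
        exact Subsingleton.elim _ _
    · intro g
      refine ⟨fun i => if hi : s i then g ⟨i, hi⟩ else 0, ?_⟩
      funext i
      simp [i.2])

/-- Discarding the trivial factors `F[X] ⧸ (p ^ 0)`. -/
noncomputable def piPosEquiv {ι : Type} (p : ι → F[X]) (e : ι → ℕ) :
    (Π i, F[X] ⧸ Submodule.span F[X] {p i ^ e i}) ≃ₗ[F[X]]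
      Π i : {i // 0 < e i}, F[X] ⧸ Submodule.span F[X] {p i.1 ^ e i.1} :=
  piSubtypeLinearEquiv _ (fun i => 0 < e i) fun i hi => by
    rw [Submodule.Quotient.subsingleton_iff, Nat.eq_zero_of_not_pos hi, pow_zero]
    exact Ideal.span_singleton_one

lemma isConj_of_prod_eq [Fintype F] {x y : GL (Fin n) F} {ι κ : Type} [Fintype ι] [Fintype κ]
    {p : ι → F[X]} {e : ι → ℕ} {p' : κ → F[X]} {e' : κ → ℕ}
    (hx : HasElementaryDivisors x.val p e) (hy : HasElementaryDivisors y.val p' e')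
    (h : ∀ k, 0 < k → ∏ i with e i = k, p i = ∏ i with e' i = k, p' i) : IsConj x y := by
  classical
  have hms : ∀ k, 0 < k → (Finset.univ.filter fun i => e i = k).val.map p =
      (Finset.univ.filter fun i => e' i = k).val.map p' := by
    intro k hk
    refine multiset_eq_of_prod_eq ?_ ?_ (h k hk)
    · intro r hr
      obtain ⟨i, -, rfl⟩ := Multiset.mem_map.mp hr
      exact hx.1 i
    · intro r hr
      obtain ⟨i, -, rfl⟩ := Multiset.mem_map.mp hr
      exact hy.1 i
  have hcard : ∀ c : F[X] × ℕ, Nonempty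
      ({i : {i // 0 < e i} // (p i.1, e i.1) = c} ≃ {i : {i // 0 < e' i} // (p' i.1, e' i.1) = c}) := by
    rintro ⟨r, k⟩
    rcases Nat.eq_zero_or_pos k with rfl | hk
    · have h1 : IsEmpty {i : {i // 0 < e i} // (p i.1, e i.1) = (r, 0)} :=
        ⟨fun i => i.1.2.ne' (Prod.ext_iff.mp i.2).2⟩
      have h2 : IsEmpty {i : {i // 0 < e' i} // (p' i.1, e' i.1) = (r, 0)} :=
        ⟨fun i => i.1.2.ne' (Prod.ext_iff.mp i.2).2⟩
      exact ⟨Equiv.equivOfIsEmpty _ _⟩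
    · have hc := congrArg (Multiset.count r) (hms k hk)
      rw [Multiset.count_map, Multiset.count_map, ← Finset.filter_val, ← Finset.filter_val,
        Finset.card_val, Finset.card_val, Finset.filter_filter, Finset.filter_filter,
        ← Fintype.card_subtype, ← Fintype.card_subtype] at hc
      have aux : ∀ {α : Type} (p : α → F[X]) (e : α → ℕ),
          Nonempty ({i // e i = k ∧ r = p i} ≃ {i : {i // 0 < e i} // (p i.1, e i.1) = (r, k)}) :=
        fun p e => ⟨⟨fun i => ⟨⟨i.1, by rw [i.2.1]; exact hk⟩, Prod.ext i.2.2.symm i.2.1⟩,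
          fun i => ⟨i.1.1, (Prod.ext_iff.mp i.2).2, (Prod.ext_iff.mp i.2).1.symm⟩,
          fun _ => rfl, fun _ => rfl⟩⟩
      obtain ⟨u⟩ := aux p e
      obtain ⟨v⟩ := aux p' e'
      exact ⟨u.symm.trans ((Fintype.equivOfCardEq hc).trans v)⟩
  let τ := fun c => (hcard c).some
  let σ := Equiv.ofFiberEquiv τ
  have hσ : ∀ i, (p' (σ i).1, e' (σ i).1) = (p i.1, e i.1) := Equiv.ofFiberEquiv_map τ
  obtain ⟨φ⟩ := hx.2
  obtain ⟨ψ⟩ := hy.2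
  let θ : AEval' (Matrix.toLin' x.val) ≃ₗ[F[X]] AEval' (Matrix.toLin' y.val) :=
    φ.trans ((piPosEquiv p e).trans (((LinearEquiv.piCongrRight fun i =>
      Submodule.quotEquivOfEq _ _ (by
        rw [(Prod.mk.inj (hσ i)).1, (Prod.mk.inj (hσ i)).2])).trans
      (LinearEquiv.piCongrLeft F[X]
        (fun j : {j // 0 < e' j} => F[X] ⧸ Submodule.span F[X] {p' j.1 ^ e' j.1}) σ)).trans
      ((piPosEquiv p' e').symm.trans ψ.symm)))
  let L : (Fin n → F) ≃ₗ[F] (Fin n → F) :=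
    (AEval'.of (Matrix.toLin' x.val)).trans
      ((θ.restrictScalars F).trans (AEval'.of (Matrix.toLin' y.val)).symm)
  have hL : ∀ v, L (x.val *ᵥ v) = y.val *ᵥ (L v) := by
    intro v
    have h1 : AEval'.of (Matrix.toLin' x.val) (x.val *ᵥ v) =
        (X : F[X]) • AEval'.of (Matrix.toLin' x.val) v := by
      rw [AEval'.X_smul_of, Matrix.toLin'_apply]
    simp only [L, LinearEquiv.trans_apply, LinearEquiv.restrictScalars_apply, h1, map_smul]
    rw [AEval'.of_symm_X_smul, Matrix.toLin'_apply]
  rw [isConj_iff]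
  refine ⟨⟨LinearMap.toMatrix' L.toLinearMap, LinearMap.toMatrix' L.symm.toLinearMap,
    ?_, ?_⟩, ?_⟩
  · rw [← LinearMap.toMatrix'_comp, L.comp_symm, LinearMap.toMatrix'_id]
  · rw [← LinearMap.toMatrix'_comp, L.symm_comp, LinearMap.toMatrix'_id]
  · rw [mul_inv_eq_iff_eq_mul]
    apply Units.ext
    apply Matrix.toLin'.injective
    apply LinearMap.ext
    intro v
    simpa [Matrix.toLin'_mul] using hL v

variable (n F) in
/-- Tuples `h` of monic self-reciprocal polynomials with `∑ (j + 1) * deg (h j) = n`. -/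
def selfReciprocalTuples : Set (Fin n → F[X]) :=
  {h | (∀ j, (h j).Monic ∧ monicReverse (h j) = h j) ∧
    ∑ j, (j.val + 1) * (h j).natDegree = n}

lemma sum_mul_natDegree_prod [Fintype F] {A : Matrix (Fin n) (Fin n) F} {ι : Type} [Fintype ι]
    {p : ι → F[X]} {e : ι → ℕ} (h : HasElementaryDivisors A p e) :
    ∑ j : Fin n, (j.val + 1) * (∏ i with e i = j.val + 1, p i).natDegree = n := by
  conv_rhs => rw [← sum_mul_natDegree h]
  have h1 : ∀ j : Fin n, (j.val + 1) * (∏ i with e i = j.val + 1, p i).natDegree =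
      ∑ i, if e i = j.val + 1 then e i * (p i).natDegree else 0 := by
    intro j
    rw [natDegree_prod_of_monic _ _ fun i _ => (h.1 i).1, Finset.mul_sum, Finset.sum_filter]
    refine Finset.sum_congr rfl fun i _ => ?_
    split_ifs with hi
    · rw [hi]
    · rfl
  rw [Finset.sum_congr rfl fun j _ => h1 j, Finset.sum_comm]
  refine Finset.sum_congr rfl fun i _ => ?_
  rcases Nat.eq_zero_or_pos (e i) with hi | hi
  · simp [hi]
  · have hle := exponent_le h i
    rw [Finset.sum_eq_single ⟨e i - 1, by omega⟩]
    · rw [if_pos (by simp only; omega)]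
    · intro j _ hj
      rw [if_neg]
      intro hh
      exact hj (Fin.ext (by simp only; omega))
    · simp

/-- A complete invariant of conjugacy in `GL(n,F)` which takes values in self-reciprocal tuples on
the elements preserving some nondegenerate bilinear form. -/
lemma exists_conjugacy_invariant [Fintype F] (n : ℕ) :
    ∃ Φ : GL (Fin n) F → Fin n → F[X],
      (∀ x a : GL (Fin n) F, x.val * a.val * x.valᵀ = a.val →
        Φ x ∈ selfReciprocalTuples F n) ∧
      ∀ x y, Φ x = Φ y → IsConj x y := by
  choose ι hι p e h using fun x : GL (Fin n) F => exists_hasElementaryDivisors x.val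
  refine ⟨fun x j => ∏ i with e x i = j.val + 1, p x i, ?_, ?_⟩
  · intro x a hxa
    exact ⟨fun j => ⟨monic_prod_of_monic _ _ fun i _ => ((h x).1 i).1,
      monicReverse_prod_filter hxa (h x) (Nat.succ_pos _)⟩, sum_mul_natDegree_prod (h x)⟩
  · intro x y hxy
    refine isConj_of_prod_eq (h x) (h y) fun k hk => ?_
    rcases le_or_gt k n with hkn | hkn
    · have := congrFun hxy ⟨k - 1, by omega⟩
      simpa only [Nat.sub_add_cancel hk] using this
    · rw [Finset.filter_false_of_mem, Finset.filter_false_of_mem, Finset.prod_empty,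
        Finset.prod_empty]
      · intro i _
        have := exponent_le (h y) i
        omega
      · intro i _
        have := exponent_le (h x) i
        omega

end Invariants

section OrbitCounting

/-- In a set of mutually conjugate elements, the centralizer orders add up to at most `|G|`. -/
lemma sum_card_centralizer_le {G : Type*} [Group G] [Fintype G] [DecidableEq G] (s : Finset G)
    (x₀ : G) (hs : ∀ x ∈ s, IsConj x₀ x) :
    ∑ x ∈ s, Fintype.card {g // g * x = x * g} ≤ Fintype.card G := by
  have ht : ∀ x : s, ∃ t : G, t * x₀ * t⁻¹ = x.1 := fun x => isConj_iff.mp (hs x.1 x.2)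
  choose t ht using ht
  rw [← Finset.sum_coe_sort, ← Fintype.card_sigma]
  refine Fintype.card_le_of_injective (fun y => y.2.1 * t y.1) ?_
  rintro ⟨x, g, hg⟩ ⟨y, k, hk⟩ h
  have key : ∀ (x : s) (g : G), g * x.1 = x.1 * g → (g * t x) * x₀ * (g * t x)⁻¹ = x.1 := by
    intro x g hg
    rw [_root_.mul_inv_rev, ← mul_assoc, mul_assoc g, mul_assoc g, ht, hg, mul_inv_cancel_right]
  simp only at h
  have hxy : x = y := Subtype.ext (by rw [← key x g hg, h, key y k hk])
  subst hxy
  obtain rfl := mul_right_cancel h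
  rfl

variable {F : Type} [Field F] {n : ℕ}

variable (F n) in
/-- Nondegenerate Gram matrices, with `GL(n,F)` acting by congruence. -/
def GramMatrix : Type := GL (Fin n) F

/-- The transpose of an invertible matrix. -/
def unitsTranspose (x : GL (Fin n) F) : GL (Fin n) F :=
  ⟨x.valᵀ, (x⁻¹).valᵀ, by rw [← Matrix.transpose_mul, Units.inv_mul, Matrix.transpose_one],
    by rw [← Matrix.transpose_mul, Units.mul_inv, Matrix.transpose_one]⟩

lemma unitsTranspose_mul (x y : GL (Fin n) F) :
    unitsTranspose (x * y) = unitsTranspose y * unitsTranspose x :=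
  Units.ext (Matrix.transpose_mul _ _)

lemma unitsTranspose_one : unitsTranspose (1 : GL (Fin n) F) = 1 :=
  Units.ext Matrix.transpose_one

/-- The underlying invertible matrix of a Gram matrix. -/
def GramMatrix.toGL (a : GramMatrix F n) : GL (Fin n) F := a

/-- An invertible matrix, regarded as a Gram matrix. -/
def GramMatrix.ofGL (a : GL (Fin n) F) : GramMatrix F n := a

instance : MulAction (GL (Fin n) F) (GramMatrix F n) where
  smul x a := .ofGL (x * a.toGL * unitsTranspose x)
  one_smul a := by
    change 1 * a.toGL * unitsTranspose 1 = a.toGL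
    rw [unitsTranspose_one, mul_one, one_mul]
  mul_smul x y a := by
    change (x * y) * a.toGL * unitsTranspose (x * y) =
      x * (y * a.toGL * unitsTranspose y) * unitsTranspose x
    simp only [unitsTranspose_mul, mul_assoc]

lemma GramMatrix.toGL_smul (x : GL (Fin n) F) (a : GramMatrix F n) :
    (x • a).toGL = x * a.toGL * unitsTranspose x := rfl

lemma GramMatrix.toGL_of_mem_fixedBy {x : GL (Fin n) F} {a : GramMatrix F n}
    (h : a ∈ MulAction.fixedBy (GramMatrix F n) x) :
    x * a.toGL * unitsTranspose x = a.toGL := by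
  rw [← GramMatrix.toGL_smul, MulAction.mem_fixedBy.mp h]

instance [Finite F] : Finite (GramMatrix F n) := inferInstanceAs (Finite (GL (Fin n) F))

lemma natCard_quot_congRel_le_natCard_orbits [Finite F] :
    Nat.card (Quot (congRel (n := n) (F := F))) ≤
      Nat.card (Quotient (MulAction.orbitRel (GL (Fin n) F) (GramMatrix F n))) := by
  refine Nat.card_le_card_of_surjective
    (Quotient.lift (fun a : GramMatrix F n => Quot.mk congRel a.toGL) ?_) ?_
  · rintro a b ⟨x, hx⟩
    exact (Quot.sound ⟨x, (congrArg (fun c => c.toGL.val) hx).symm⟩).symm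
  · rintro ⟨a⟩
    exact ⟨Quotient.mk _ (.ofGL a), rfl⟩

open scoped Classical in
lemma card_fixedBy_le_card_centralizer [Fintype F] (x a₀ : GL (Fin n) F)
    (h₀ : x * a₀ * unitsTranspose x = a₀) [Fintype (MulAction.fixedBy (GramMatrix F n) x)] :
    Fintype.card (MulAction.fixedBy (GramMatrix F n) x) ≤
      Fintype.card {g : GL (Fin n) F // g * x = x * g} := by
  have hmem : ∀ a : GL (Fin n) F, x * a * unitsTranspose x = a →
      (a * a₀⁻¹) * x = x * (a * a₀⁻¹) := by
    intro a ha
    have h1 : unitsTranspose x = a₀⁻¹ * x⁻¹ * a₀ := by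
      rw [mul_assoc, eq_inv_mul_iff_mul_eq, eq_inv_mul_iff_mul_eq, ← mul_assoc, h₀]
    rw [h1] at ha
    conv_lhs => rw [← ha]
    group
  refine Fintype.card_le_of_injective
    (fun a => ⟨a.1.toGL * a₀⁻¹, hmem _ (GramMatrix.toGL_of_mem_fixedBy a.2)⟩) fun a b hab => ?_
  have h := mul_right_cancel (Subtype.ext_iff.mp hab)
  exact Subtype.ext h

/-- The number of congruence classes is at most the number of self-reciprocal tuples. -/
lemma natCard_quot_congRel_le_ncard [Fintype F] (hfin : (selfReciprocalTuples F n).Finite) :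
    Nat.card (Quot (congRel (n := n) (F := F))) ≤ (selfReciprocalTuples F n).ncard := by
  classical
  refine natCard_quot_congRel_le_natCard_orbits.trans ?_
  have := Fintype.ofFinite (GramMatrix F n)
  obtain ⟨Φ, hΦ, hconj⟩ := exists_conjugacy_invariant (F := F) n
  have hb := MulAction.sum_card_fixedBy_eq_card_orbits_mul_card_group (GL (Fin n) F)
    (GramMatrix F n)
  rw [Nat.card_eq_fintype_card, Set.ncard_eq_toFinset_card _ hfin]
  refine Nat.le_of_mul_le_mul_right ?_ (Fintype.card_pos (α := GL (Fin n) F))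
  rw [← hb]
  let X : Finset (GL (Fin n) F) := {x | ∃ a : GL (Fin n) F, x * a * unitsTranspose x = a}
  have hX : ∀ x ∈ X, Φ x ∈ hfin.toFinset := by
    intro x hx
    obtain ⟨a, ha⟩ := (Finset.mem_filter.mp hx).2
    exact hfin.mem_toFinset.mpr (hΦ x a (congrArg Units.val ha))
  calc ∑ x : GL (Fin n) F, Fintype.card (MulAction.fixedBy (GramMatrix F n) x)
      = ∑ x ∈ X, Fintype.card (MulAction.fixedBy (GramMatrix F n) x) := by
        refine (Finset.sum_subset (Finset.subset_univ X) fun x _ hx => ?_).symm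
        rw [Fintype.card_eq_zero_iff]
        exact ⟨fun a => hx (Finset.mem_filter.mpr ⟨Finset.mem_univ x, a.1.toGL,
          GramMatrix.toGL_of_mem_fixedBy a.2⟩)⟩
    _ ≤ ∑ x ∈ X, Fintype.card {g : GL (Fin n) F // g * x = x * g} := by
        refine Finset.sum_le_sum fun x hx => ?_
        obtain ⟨a, ha⟩ := (Finset.mem_filter.mp hx).2
        exact card_fixedBy_le_card_centralizer x a ha
    _ = ∑ h ∈ hfin.toFinset, ∑ x ∈ X with Φ x = h,
          Fintype.card {g : GL (Fin n) F // g * x = x * g} :=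
        (Finset.sum_fiberwise_of_maps_to hX _).symm
    _ ≤ ∑ h ∈ hfin.toFinset, Fintype.card (GL (Fin n) F) := by
        refine Finset.sum_le_sum fun h _ => ?_
        rcases (X.filter fun x => Φ x = h).eq_empty_or_nonempty with he | ⟨x₀, hx₀⟩
        · rw [he, Finset.sum_empty]
          exact Nat.zero_le _
        · refine sum_card_centralizer_le _ x₀ fun x hx => hconj _ _ ?_
          rw [(Finset.mem_filter.mp hx₀).2, (Finset.mem_filter.mp hx).2]
    _ = hfin.toFinset.card * Fintype.card (GL (Fin n) F) := by
        rw [Finset.sum_const, smul_eq_mul]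

end OrbitCounting

section CountingSelfReciprocal

open Polynomial

variable {F : Type} [Field F]

/-- Monic self-reciprocal polynomials of degree `d`. -/
def selfReciprocalPolys (F : Type) [Field F] (d : ℕ) : Set F[X] :=
  {f | f.Monic ∧ monicReverse f = f ∧ f.natDegree = d}

/-- A bound for the number of monic self-reciprocal polynomials of degree `d` over a field with
`q` elements, where `ε = 0` in characteristic two and `ε = 1` otherwise. -/
def selfReciprocalBound (ε q d : ℕ) : ℕ :=
  q ^ (d / 2) + ε * (if d = 0 then 0 else q ^ ((d - 1) / 2))

lemma coeff_sub_of_mem_selfReciprocalPolys {d : ℕ} {f : F[X]} (hf : f ∈ selfReciprocalPolys F d)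
    {i : ℕ} (hi : i ≤ d) : f.coeff i = (f.coeff 0)⁻¹ * f.coeff (d - i) := by
  obtain ⟨-, hr, rfl⟩ := hf
  conv_lhs => rw [← hr]
  exact coeff_monicReverse hi

lemma coeff_zero_of_mem_selfReciprocalPolys {d : ℕ} {f : F[X]}
    (hf : f ∈ selfReciprocalPolys F d) : f.coeff 0 = 1 ∨ f.coeff 0 = -1 := by
  have h := coeff_sub_of_mem_selfReciprocalPolys hf (Nat.zero_le d)
  have hd : f.coeff d = 1 := by
    rw [← hf.2.2]
    exact hf.1.coeff_natDegree
  rw [Nat.sub_zero, hd, mul_one] at h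
  rw [← mul_self_eq_one_iff]
  have h0 : f.coeff 0 ≠ 0 := by
    intro h0
    have := coeff_sub_of_mem_selfReciprocalPolys hf le_rfl
    rw [h0, _root_.inv_zero, zero_mul, hd] at this
    exact one_ne_zero this
  nth_rewrite 1 [h]
  exact inv_mul_cancel₀ h0

lemma ncard_selfReciprocalPolys_coeff_zero [Fintype F] {d r : ℕ} {c : F}
    (hd : d ≤ 2 * r + 1 ∨ (d = 2 * r + 2 ∧ c = -1 ∧ (2 : F) ≠ 0)) :
    {f ∈ selfReciprocalPolys F d | f.coeff 0 = c}.Finite ∧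
      {f ∈ selfReciprocalPolys F d | f.coeff 0 = c}.ncard ≤ Fintype.card F ^ r := by
  classical
  let φ : F[X] → Fin r → F := fun f i => f.coeff (i.val + 1)
  have hinj : Set.InjOn φ {f ∈ selfReciprocalPolys F d | f.coeff 0 = c} := by
    rintro f ⟨hf, hfc⟩ g ⟨hg, hgc⟩ hfg
    have hlow : ∀ i, i ≤ r → f.coeff i = g.coeff i := by
      intro i hi
      rcases Nat.eq_zero_or_pos i with rfl | hi0
      · rw [hfc, hgc]
      · have := congrFun hfg ⟨i - 1, by omega⟩
        simpa only [φ, Nat.sub_add_cancel hi0] using this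
    ext i
    rcases le_or_gt i r with hi | hi
    · exact hlow i hi
    rcases le_or_gt i d with hid | hid
    · rcases le_or_gt (d - i) r with hdi | hdi
      · rw [coeff_sub_of_mem_selfReciprocalPolys hf hid,
          coeff_sub_of_mem_selfReciprocalPolys hg hid, hfc, hgc, hlow _ hdi]
      · obtain ⟨hd2, hc, h2⟩ := hd.resolve_left (by omega)
        have hmid : ∀ f ∈ selfReciprocalPolys F d, f.coeff 0 = c → f.coeff i = 0 := by
          intro f hf hfc
          have h := coeff_sub_of_mem_selfReciprocalPolys hf hid
          rw [show d - i = i by omega, hfc, hc, inv_neg, inv_one, neg_one_mul,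
            eq_neg_iff_add_eq_zero, ← two_mul] at h
          exact (mul_eq_zero.mp h).resolve_left h2
        rw [hmid f hf hfc, hmid g hg hgc]
    · rw [coeff_eq_zero_of_natDegree_lt (hf.2.2.symm ▸ hid),
        coeff_eq_zero_of_natDegree_lt (hg.2.2.symm ▸ hid)]
  refine ⟨Set.Finite.of_finite_image (Set.toFinite _) hinj, ?_⟩
  refine (Set.ncard_le_ncard_of_injOn φ (fun f _ => Set.mem_univ _) hinj).trans ?_
  rw [Set.ncard_univ, Nat.card_eq_fintype_card, Fintype.card_fun, Fintype.card_fin]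

lemma ncard_selfReciprocalPolys_le [Fintype F] {ε : ℕ}
    (hε : (ε = 0 ∧ (2 : F) = 0) ∨ (ε = 1 ∧ (2 : F) ≠ 0)) (d : ℕ) :
    (selfReciprocalPolys F d).Finite ∧
      (selfReciprocalPolys F d).ncard ≤ selfReciprocalBound ε (Fintype.card F) d := by
  obtain ⟨hfin, hcard⟩ := ncard_selfReciprocalPolys_coeff_zero (F := F) (c := 1)
    (d := d) (r := d / 2) (Or.inl (by omega))
  by_cases h1 : ∀ f ∈ selfReciprocalPolys F d, f.coeff 0 = 1
  · have : selfReciprocalPolys F d = {f ∈ selfReciprocalPolys F d | f.coeff 0 = 1} :=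
      Set.ext fun f => ⟨fun hf => ⟨hf, h1 f hf⟩, fun hf => hf.1⟩
    rw [this]
    exact ⟨hfin, hcard.trans (Nat.le_add_right _ _)⟩
  · push Not at h1
    obtain ⟨f, hf, hf1⟩ := h1
    have hneg := (coeff_zero_of_mem_selfReciprocalPolys hf).resolve_left hf1
    have h2 : (2 : F) ≠ 0 := by
      intro h2
      apply hf1
      rw [hneg, neg_eq_iff_add_eq_zero, one_add_one_eq_two, h2]
    have hd : d ≠ 0 := by
      rintro rfl
      apply hf1
      rw [← hf.2.2]
      exact hf.1.coeff_natDegree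
    obtain ⟨rfl, -⟩ := hε.resolve_left fun h => h2 h.2
    obtain ⟨hfin', hcard'⟩ := ncard_selfReciprocalPolys_coeff_zero (F := F) (c := -1)
      (d := d) (r := (d - 1) / 2) (by
        rcases Nat.even_or_odd' d with ⟨m, hm | hm⟩
        · exact Or.inr ⟨by omega, rfl, h2⟩
        · exact Or.inl (by omega))
    have hunion : selfReciprocalPolys F d = {f ∈ selfReciprocalPolys F d | f.coeff 0 = 1} ∪
        {f ∈ selfReciprocalPolys F d | f.coeff 0 = -1} := by
      ext f
      refine ⟨fun hf => ?_, fun hf => hf.elim And.left And.left⟩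
      exact (coeff_zero_of_mem_selfReciprocalPolys hf).imp (⟨hf, ·⟩) (⟨hf, ·⟩)
    rw [hunion]
    refine ⟨hfin.union hfin', (Set.ncard_union_le _ _).trans ?_⟩
    rw [selfReciprocalBound, if_neg hd, one_mul]
    exact Nat.add_le_add hcard hcard'

/-- Degree vectors `d` with `∑ (j + 1) * d j = n`. -/
def degreeVectors (n : ℕ) : Finset (Fin n → ℕ) :=
  {d ∈ Fintype.piFinset fun _ => Finset.range (n + 1) | ∑ j, (j.val + 1) * d j = n}

lemma ncard_selfReciprocalTuples_le [Fintype F] {ε : ℕ}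
    (hε : (ε = 0 ∧ (2 : F) = 0) ∨ (ε = 1 ∧ (2 : F) ≠ 0)) (n : ℕ) :
    (selfReciprocalTuples F n).Finite ∧
      (selfReciprocalTuples F n).ncard ≤
        ∑ d ∈ degreeVectors n, ∏ j, selfReciprocalBound ε (Fintype.card F) (d j) := by
  classical
  have hfin := fun d => (ncard_selfReciprocalPolys_le hε d).1
  let T : Finset (Fin n → F[X]) := (degreeVectors n).biUnion fun d =>
    Fintype.piFinset fun j => (hfin (d j)).toFinset
  have hsub : selfReciprocalTuples F n ⊆ T := by
    rintro h ⟨hh, hsum⟩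
    rw [Finset.mem_coe, Finset.mem_biUnion]
    refine ⟨fun j => (h j).natDegree, Finset.mem_filter.mpr ⟨?_, hsum⟩, ?_⟩
    · rw [Fintype.mem_piFinset]
      intro j
      rw [Finset.mem_range]
      have h1 : (j.val + 1) * (h j).natDegree ≤ _ := Finset.single_le_sum
        (f := fun j : Fin n => (j.val + 1) * (h j).natDegree)
        (fun _ _ => Nat.zero_le _) (Finset.mem_univ j)
      have h2 := Nat.le_mul_of_pos_left (h j).natDegree (Nat.succ_pos j.val)
      simp only [Nat.succ_eq_add_one] at h2
      omega
    · rw [Fintype.mem_piFinset]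
      exact fun j => (hfin _).mem_toFinset.mpr ⟨(hh j).1, (hh j).2, rfl⟩
  refine ⟨T.finite_toSet.subset hsub, (Set.ncard_le_ncard hsub T.finite_toSet).trans ?_⟩
  rw [Set.ncard_coe_finset]
  refine Finset.card_biUnion_le.trans (Finset.sum_le_sum fun d _ => ?_)
  rw [Fintype.card_piFinset]
  refine Finset.prod_le_prod' fun j _ => ?_
  rw [← Set.ncard_eq_toFinset_card _ (hfin (d j))]
  exact (ncard_selfReciprocalPolys_le hε (d j)).2

end CountingSelfReciprocal

section Estimates

/-- The generating function of `selfReciprocalBound ε b`. -/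
noncomputable def selfReciprocalGenFun (ε b : ℕ) (z : ℝ) : ℝ :=
  (1 + z) * (1 + ε * z) / (1 - b * z ^ 2)

lemma selfReciprocalBound_add_two {ε b : ℕ} (d : ℕ) :
    selfReciprocalBound ε b (d + 2) =
      b * selfReciprocalBound ε b d + if d = 0 then ε else 0 := by
  rw [selfReciprocalBound, selfReciprocalBound, if_neg (by omega),
    show (d + 2) / 2 = d / 2 + 1 by omega, pow_succ']
  rcases Nat.eq_zero_or_pos d with rfl | hd
  · simp
  · rw [if_neg hd.ne', if_neg hd.ne', show (d + 2 - 1) / 2 = (d - 1) / 2 + 1 by omega, pow_succ']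
    ring

lemma sum_selfReciprocalBound_le {ε b : ℕ} {z : ℝ} (hz : 0 ≤ z) (hbz : b * z ^ 2 < 1) (N : ℕ) :
    ∑ d ∈ Finset.range N, (selfReciprocalBound ε b d : ℝ) * z ^ d ≤
      selfReciprocalGenFun ε b z := by
  have hnn : ∀ d, 0 ≤ (selfReciprocalBound ε b d : ℝ) * z ^ d := fun d => by positivity
  set P : ℕ → ℝ := fun N => ∑ d ∈ Finset.range N, (selfReciprocalBound ε b d : ℝ) * z ^ d with hP
  have hrec : ∀ N, P (N + 1 + 2) = (1 + z) * (1 + ε * z) + b * z ^ 2 * P (N + 1) := by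
    intro N
    simp only [hP]
    rw [Finset.sum_range_succ', Finset.sum_range_succ']
    have h1 : ∀ d, (selfReciprocalBound ε b (d + 1 + 1) : ℝ) * z ^ (d + 1 + 1) =
        b * z ^ 2 * (selfReciprocalBound ε b d * z ^ d) + if d = 0 then ε * z ^ 2 else 0 := by
      intro d
      rw [show d + 1 + 1 = d + 2 from rfl, selfReciprocalBound_add_two]
      rcases Nat.eq_zero_or_pos d with rfl | hd
      · push_cast
        ring
      · push_cast
        rw [if_neg hd.ne', if_neg hd.ne']
        ring
    simp only [h1]
    rw [Finset.sum_add_distrib, ← Finset.mul_sum, Finset.sum_ite_eq' (Finset.range (N + 1)) 0]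
    simp [selfReciprocalBound]
    ring
  have hmono : P N ≤ P (N + 1 + 2) :=
    Finset.sum_le_sum_of_subset_of_nonneg (Finset.range_mono (by omega)) fun d _ _ => hnn d
  have hmono' : P (N + 1) ≤ P (N + 1 + 2) :=
    Finset.sum_le_sum_of_subset_of_nonneg (Finset.range_mono (by omega)) fun d _ _ => hnn d
  refine hmono.trans ?_
  rw [selfReciprocalGenFun, le_div_iff₀ (by linarith)]
  have := hrec N
  have hb : 0 ≤ b * z ^ 2 := by positivity
  nlinarith

lemma one_le_selfReciprocalGenFun {ε b : ℕ} {z : ℝ} (hz : 0 ≤ z) (hbz : b * z ^ 2 < 1) :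
    1 ≤ selfReciprocalGenFun ε b z := by
  have h := sum_selfReciprocalBound_le (ε := ε) hz hbz 1
  simpa [selfReciprocalBound] using h

lemma selfReciprocalBound_le_mul_pow (ε : ℕ) {b q : ℕ} (hb : 0 < b) (hbq : b ≤ q) (d : ℕ) :
    (selfReciprocalBound ε q d : ℝ) ≤ selfReciprocalBound ε b d * ((q : ℝ) / b) ^ (d / 2) := by
  have hb' : (0 : ℝ) < b := by exact_mod_cast hb
  have hρ : (1 : ℝ) ≤ (q : ℝ) / b := by
    rw [one_le_div hb']
    exact_mod_cast hbq
  have hq : (q : ℝ) = b * ((q : ℝ) / b) := by field_simp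
  set ρ := (q : ℝ) / b
  rw [selfReciprocalBound, selfReciprocalBound]
  push_cast
  rw [add_mul, hq, mul_pow]
  refine add_le_add le_rfl ?_
  rw [mul_assoc]
  refine mul_le_mul_of_nonneg_left ?_ (Nat.cast_nonneg ε)
  split_ifs with hd
  · simp
  · rw [mul_pow]
    exact mul_le_mul_of_nonneg_left (pow_le_pow_right₀ hρ (by omega)) (by positivity)

lemma sum_half_le_half_of_mem_degreeVectors {n : ℕ} {d : Fin n → ℕ} (hd : d ∈ degreeVectors n) :
    ∑ j, d j / 2 ≤ n / 2 := by
  rw [Nat.le_div_iff_mul_le two_pos, Finset.sum_mul]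
  conv_rhs => rw [← (Finset.mem_filter.mp hd).2]
  refine Finset.sum_le_sum fun j _ => ?_
  have := Nat.le_mul_of_pos_left (d j) (Nat.succ_pos j.val)
  simp only [Nat.succ_eq_add_one] at this
  omega

lemma prod_selfReciprocalBound_le (ε : ℕ) {b q : ℕ} (hb : 0 < b) (hbq : b ≤ q) {n : ℕ}
    {d : Fin n → ℕ} (hd : d ∈ degreeVectors n) :
    ∏ j, (selfReciprocalBound ε q (d j) : ℝ) ≤
      (∏ j, (selfReciprocalBound ε b (d j) : ℝ)) * ((q : ℝ) / b) ^ (n / 2) := by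
  have hb' : (0 : ℝ) < b := by exact_mod_cast hb
  have hρ : (1 : ℝ) ≤ (q : ℝ) / b := by
    rw [one_le_div hb']
    exact_mod_cast hbq
  calc ∏ j, (selfReciprocalBound ε q (d j) : ℝ)
      ≤ ∏ j, (selfReciprocalBound ε b (d j) * ((q : ℝ) / b) ^ (d j / 2)) :=
        Finset.prod_le_prod (fun _ _ => by positivity)
          fun j _ => selfReciprocalBound_le_mul_pow ε hb hbq (d j)
    _ = (∏ j, (selfReciprocalBound ε b (d j) : ℝ)) * ((q : ℝ) / b) ^ (∑ j, d j / 2) := by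
        rw [Finset.prod_mul_distrib, Finset.prod_pow_eq_pow_sum]
    _ ≤ _ := by
        refine mul_le_mul_of_nonneg_left ?_ (by positivity)
        exact pow_le_pow_right₀ hρ (sum_half_le_half_of_mem_degreeVectors hd)

/-- Bounding a coefficient of the product of generating functions, with the factor of index `0`
treated by a pointwise bound. -/
lemma sum_prod_selfReciprocalBound_le {ε b m : ℕ} {x c : ℝ} (hx : 0 < x) (hx1 : x < 1)
    (hbx : b * x ^ 2 = 1) (hc : ∀ d, (selfReciprocalBound ε b d : ℝ) * x ^ d ≤ c) :
    (∑ d ∈ degreeVectors (m + 1), ∏ j, (selfReciprocalBound ε b (d j) : ℝ)) * x ^ (m + 1) ≤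
      c * ∏ j ∈ Finset.range m, selfReciprocalGenFun ε b (x ^ (j + 2)) := by
  classical
  have hc0 : 0 ≤ c := le_trans (by positivity) (hc 0)
  let G : (Fin m → ℕ) → ℝ := fun t =>
    ∏ j : Fin m, ((selfReciprocalBound ε b (t j) : ℝ) * (x ^ (j.val + 2)) ^ t j)
  have hG : ∀ t, 0 ≤ G t := fun t => Finset.prod_nonneg fun _ _ => by positivity
  have hterm : ∀ d ∈ degreeVectors (m + 1),
      (∏ j, (selfReciprocalBound ε b (d j) : ℝ)) * x ^ (m + 1) ≤ c * G (Fin.tail d) := by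
    intro d hd
    have h1 : x ^ (m + 1) = ∏ j : Fin (m + 1), (x ^ (j.val + 1)) ^ d j := by
      simp only [← pow_mul]
      rw [Finset.prod_pow_eq_pow_sum, (Finset.mem_filter.mp hd).2]
    rw [h1, ← Finset.prod_mul_distrib, Fin.prod_univ_succ]
    refine mul_le_mul ?_ le_rfl (hG _) hc0
    simpa using hc (d 0)
  have hinj : Set.InjOn (Fin.tail : (Fin (m + 1) → ℕ) → Fin m → ℕ) (degreeVectors (m + 1)) := by
    intro d hd d' hd' h
    have e1 := (Finset.mem_filter.mp hd).2
    have e2 := (Finset.mem_filter.mp hd').2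
    rw [Fin.sum_univ_succ] at e1 e2
    have h2 : ∀ j : Fin m, d j.succ = d' j.succ := fun j => congrFun h j
    have h0 : d 0 = d' 0 := by
      simp only [h2] at e1
      simp only [Fin.val_zero, zero_add, one_mul] at e1 e2
      omega
    funext j
    exact Fin.cases h0 h2 j
  calc (∑ d ∈ degreeVectors (m + 1), ∏ j, (selfReciprocalBound ε b (d j) : ℝ)) * x ^ (m + 1)
      ≤ ∑ d ∈ degreeVectors (m + 1), c * G (Fin.tail d) := by
        rw [Finset.sum_mul]
        exact Finset.sum_le_sum hterm
    _ = c * ∑ t ∈ (degreeVectors (m + 1)).image Fin.tail, G t := by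
        rw [Finset.sum_image hinj, Finset.mul_sum]
    _ ≤ c * ∑ t ∈ Fintype.piFinset fun _ : Fin m => Finset.range (m + 1 + 1), G t := by
        refine mul_le_mul_of_nonneg_left
          (Finset.sum_le_sum_of_subset_of_nonneg ?_ fun t _ _ => hG t) hc0
        intro t ht
        obtain ⟨d, hd, rfl⟩ := Finset.mem_image.mp ht
        rw [Fintype.mem_piFinset]
        exact fun j => Fintype.mem_piFinset.mp (Finset.mem_filter.mp hd).1 j.succ
    _ = c * ∏ j : Fin m, ∑ d ∈ Finset.range (m + 1 + 1),
          (selfReciprocalBound ε b d : ℝ) * (x ^ (j.val + 2)) ^ d := by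
        rw [Finset.prod_univ_sum]
    _ ≤ c * ∏ j : Fin m, selfReciprocalGenFun ε b (x ^ (j.val + 2)) := by
        refine mul_le_mul_of_nonneg_left (Finset.prod_le_prod
          (fun _ _ => Finset.sum_nonneg fun _ _ => by positivity) fun j _ => ?_) hc0
        refine sum_selfReciprocalBound_le (by positivity) ?_ _
        have h3 : (x ^ (j.val + 2)) ^ 2 = x ^ 2 * (x ^ (j.val + 1)) ^ 2 := by ring
        rw [h3, ← mul_assoc, hbx, one_mul]
        exact pow_lt_one₀ (by positivity) (pow_lt_one₀ hx.le hx1 (by omega)) two_ne_zero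
    _ = _ := by rw [Finset.prod_range (fun j => selfReciprocalGenFun ε b (x ^ (j + 2)))]

lemma prod_range_le_of_step {S w : ℕ → ℝ} {B : ℝ} {m₀ : ℕ} (hS : ∀ j, 1 ≤ S j)
    (hbase : ∏ j ∈ Finset.range m₀, S j ≤ w m₀) (hstep : ∀ j, S j * w j ≤ w (j + 1))
    (hw : ∀ j, w j ≤ B) (m : ℕ) : ∏ j ∈ Finset.range m, S j ≤ B := by
  have hmono : Monotone fun m => ∏ j ∈ Finset.range m, S j := by
    refine monotone_nat_of_le_succ fun m => ?_
    rw [Finset.prod_range_succ]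
    exact le_mul_of_one_le_right
      (Finset.prod_nonneg fun j _ => zero_le_one.trans (hS j)) (hS m)
  have htail : ∀ k, ∏ j ∈ Finset.range (m₀ + k), S j ≤ w (m₀ + k) := by
    intro k
    induction k with
    | zero => exact hbase
    | succ k ih =>
      rw [← add_assoc, Finset.prod_range_succ, mul_comm]
      exact (mul_le_mul_of_nonneg_left ih (zero_le_one.trans (hS _))).trans (hstep _)
  exact (hmono (Nat.le_add_left m m₀)).trans ((htail m).trans (hw _))

lemma selfReciprocalGenFun_mul_le {ε b : ℕ} {x t K : ℝ} (hbx : b * x ^ 2 = 1) (ht1 : t < 1)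
    (ht : 0 ≤ t) (h : (1 + x * t) * (1 + ε * (x * t)) * (1 - K * t) ≤
      (1 - t ^ 2) * (1 - K * (x * t))) :
    selfReciprocalGenFun ε b (x * t) * (1 - K * t) ≤ 1 - K * (x * t) := by
  have h1 : b * (x * t) ^ 2 = t ^ 2 := by rw [mul_pow, ← mul_assoc, hbx, one_mul]
  rw [selfReciprocalGenFun, h1, div_mul_eq_mul_div, div_le_iff₀ (by nlinarith), mul_comm _ (1 - t ^ 2)]
  exact h

/-- A uniform bound for the finite products of generating functions, given a comparison of the
partial product of length `m₀` with the tail weight. -/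
lemma prod_selfReciprocalGenFun_le {ε b m₀ : ℕ} {x K B : ℝ} (hx : 0 < x) (hx1 : x < 1)
    (hbx : b * x ^ 2 = 1) (hB : 0 ≤ B) (hK : 0 ≤ K)
    (hstep : ∀ t : ℝ, 0 ≤ t → t < 1 → (1 + x * t) * (1 + ε * (x * t)) * (1 - K * t) ≤
      (1 - t ^ 2) * (1 - K * (x * t)))
    (hbase : ∏ j ∈ Finset.range m₀, selfReciprocalGenFun ε b (x ^ (j + 2)) ≤
      B * (1 - K * x ^ (m₀ + 1))) (m : ℕ) :
    ∏ j ∈ Finset.range m, selfReciprocalGenFun ε b (x ^ (j + 2)) ≤ B := by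
  have hlt : ∀ j : ℕ, x ^ (j + 1) < 1 := fun j => pow_lt_one₀ hx.le hx1 (by omega)
  refine prod_range_le_of_step (w := fun j => B * (1 - K * x ^ (j + 1))) (fun j => ?_) hbase
    (fun j => ?_) (fun j => ?_) m
  · refine one_le_selfReciprocalGenFun (by positivity) ?_
    have h3 : (x ^ (j + 2)) ^ 2 = x ^ 2 * (x ^ (j + 1)) ^ 2 := by ring
    rw [h3, ← mul_assoc, hbx, one_mul]
    exact pow_lt_one₀ (by positivity) (hlt j) two_ne_zero
  · have h := selfReciprocalGenFun_mul_le (K := K) hbx (hlt j) (by positivity)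
      (hstep _ (by positivity) (hlt j))
    rw [← pow_succ' x (j + 1)] at h
    calc _ = B * (selfReciprocalGenFun ε b (x ^ (j + 1 + 1)) * (1 - K * x ^ (j + 1))) := by ring
      _ ≤ _ := mul_le_mul_of_nonneg_left h hB
  · have : 0 ≤ K * x ^ (j + 1) := by positivity
    nlinarith

lemma prod_genFun_three_le {x : ℝ} (hx : 0 < x) (hx2 : x ^ 2 = 1 / 3) (m : ℕ) :
    ∏ j ∈ Finset.range m, selfReciprocalGenFun 1 3 (x ^ (j + 2)) ≤ 9 := by
  have hxl : 0.577 < x := by nlinarith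
  have hxu : x < 0.5774 := by nlinarith
  refine prod_selfReciprocalGenFun_le (m₀ := 3) (K := 3) hx (by linarith)
    (by rw [hx2]; norm_num) (by norm_num) (by norm_num) (fun t ht ht1 => ?_) ?_ m
  · have h1 : 0 ≤ t * (3 - 5 * x) := mul_nonneg ht (by linarith)
    have h2 : 0 ≤ t ^ 2 * (6 * x - 4 / 3) := mul_nonneg (by positivity) (by linarith)
    have h3 : 0 ≤ t ^ 3 * (1 + 3 * x) := by positivity
    have key : (1 - t ^ 2) * (1 - 3 * (x * t)) -
        (1 + x * t) * (1 + (1 : ℕ) * (x * t)) * (1 - 3 * t) =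
        t * (3 - 5 * x) + t ^ 2 * (6 * x - 4 / 3) + t ^ 3 * (1 + 3 * x) +
          (x ^ 2 - 1 / 3) * (3 * t ^ 3 - t ^ 2) := by
      push_cast
      ring
    rw [hx2, sub_self, zero_mul, add_zero] at key
    exact sub_nonneg.mp (key ▸ add_nonneg (add_nonneg h1 h2) h3)
  · have e3 : x ^ 3 = x / 3 := by rw [pow_succ, hx2]; ring
    have e4 : x ^ 4 = 1 / 9 := by rw [show x ^ 4 = (x ^ 2) ^ 2 by ring, hx2]; norm_num
    have e6 : (x / 3) ^ 2 = 1 / 27 := by rw [div_pow, hx2]; norm_num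
    simp only [Finset.prod_range_succ, Finset.prod_range_zero, Nat.reduceAdd, one_mul, zero_add,
      selfReciprocalGenFun, hx2, e3, e4, e6]
    have e7 : (1 + x / 3) * (1 + ((1 : ℕ) : ℝ) * (x / 3)) = 1 + 2 / 3 * x + 1 / 27 := by
      push_cast
      linear_combination e6
    rw [e7]
    norm_num
    linarith

lemma prod_genFun_two_le {x : ℝ} (hx : 0 < x) (hx2 : x ^ 2 = 1 / 2) (m : ℕ) :
    ∏ j ∈ Finset.range m, selfReciprocalGenFun 0 2 (x ^ (j + 2)) ≤ 19 := by
  have hxl : 0.7071 < x := by nlinarith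
  have hxu : x < 0.70711 := by nlinarith
  refine prod_selfReciprocalGenFun_le (m₀ := 4) (K := 5 / 2) hx (by linarith)
    (by rw [hx2]; norm_num) (by norm_num) (by norm_num) (fun t ht ht1 => ?_) ?_ m
  · have h1 : 0 ≤ t * (5 / 2 - 7 / 2 * x) := mul_nonneg ht (by linarith)
    have h2 : 0 ≤ t ^ 2 * (5 / 2 * x - 1) := mul_nonneg (by positivity) (by linarith)
    have h3 : 0 ≤ t ^ 3 * (5 / 2 * x) := by positivity
    have key : (1 - t ^ 2) * (1 - 5 / 2 * (x * t)) -
        (1 + x * t) * (1 + (0 : ℕ) * (x * t)) * (1 - 5 / 2 * t) =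
        t * (5 / 2 - 7 / 2 * x) + t ^ 2 * (5 / 2 * x - 1) + t ^ 3 * (5 / 2 * x) := by
      push_cast
      ring
    linarith
  · have e3 : x ^ 3 = x / 2 := by rw [pow_succ, hx2]; ring
    have e4 : x ^ 4 = 1 / 4 := by rw [show x ^ 4 = (x ^ 2) ^ 2 by ring, hx2]; norm_num
    have e5 : x ^ 5 = x / 4 := by rw [pow_succ, e4]; ring
    have e6 : (x / 2) ^ 2 = 1 / 8 := by rw [div_pow, hx2]; norm_num
    have e8 : (x / 4) ^ 2 = 1 / 32 := by rw [div_pow, hx2]; norm_num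
    simp only [Finset.prod_range_succ, Finset.prod_range_zero, Nat.reduceAdd, one_mul, zero_add,
      selfReciprocalGenFun, hx2, e3, e4, e5, e6, e8]
    norm_num
    nlinarith

lemma selfReciprocalBound_one_three_mul_pow_le {x : ℝ} (hx : 0 < x) (hx2 : x ^ 2 = 1 / 3)
    (d : ℕ) : (selfReciprocalBound 1 3 d : ℝ) * x ^ d ≤ 4 / 3 := by
  have hxu : x < 2 / 3 := by nlinarith
  induction d using Nat.twoStepInduction with
  | zero => norm_num [selfReciprocalBound]
  | one =>
    norm_num [selfReciprocalBound]
    linarith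
  | more d ih _ =>
    rw [selfReciprocalBound_add_two, pow_add, hx2]
    rcases Nat.eq_zero_or_pos d with rfl | hd
    · norm_num [selfReciprocalBound]
    · rw [if_neg hd.ne']
      push_cast
      linarith

lemma selfReciprocalBound_zero_two_mul_pow_le {x : ℝ} (hx : 0 < x) (hx2 : x ^ 2 = 1 / 2)
    (d : ℕ) : (selfReciprocalBound 0 2 d : ℝ) * x ^ d ≤ 1 := by
  have hxu : x < 1 := by nlinarith
  induction d using Nat.twoStepInduction with
  | zero => norm_num [selfReciprocalBound]
  | one =>
    norm_num [selfReciprocalBound]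
    linarith
  | more d ih _ =>
    rw [selfReciprocalBound_add_two, pow_add, hx2, ite_self]
    push_cast
    linarith

lemma sum_prod_selfReciprocalBound_le_mul_pow {ε b q m : ℕ} {x c B C : ℝ} (hb : 0 < b)
    (hbq : b ≤ q) (hx : 0 < x) (hx1 : x < 1) (hbx : b * x ^ 2 = 1)
    (hc : ∀ d, (selfReciprocalBound ε b d : ℝ) * x ^ d ≤ c)
    (hB : ∏ j ∈ Finset.range m, selfReciprocalGenFun ε b (x ^ (j + 2)) ≤ B)
    (hC : c * B ≤ C * x) :
    ∑ d ∈ degreeVectors (m + 1), ∏ j, (selfReciprocalBound ε q (d j) : ℝ) ≤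
      C * (q : ℝ) ^ ((m + 1) / 2) := by
  have hb' : (0 : ℝ) < b := by exact_mod_cast hb
  set n := m + 1 with hn
  have hc0 : 0 ≤ c := le_trans (by positivity) (hc 0)
  have hxn : x * ((b : ℝ) ^ (n / 2))⁻¹ ≤ x ^ n := by
    have h1 : ((b : ℝ) ^ (n / 2))⁻¹ = x ^ (2 * (n / 2)) := by
      refine inv_eq_of_mul_eq_one_right ?_
      rw [pow_mul, ← mul_pow, hbx, one_pow]
    rw [h1, ← pow_succ']
    exact pow_le_pow_of_le_one hx.le hx1.le (by omega)
  set T := ∑ d ∈ degreeVectors n, ∏ j, (selfReciprocalBound ε b (d j) : ℝ) with hT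
  have hT0 : 0 ≤ T := Finset.sum_nonneg fun _ _ => Finset.prod_nonneg fun _ _ => by positivity
  have hTC : T ≤ C * (b : ℝ) ^ (n / 2) := by
    have h1 : T * x ^ n ≤ c * B := (sum_prod_selfReciprocalBound_le hx hx1 hbx hc).trans
      (mul_le_mul_of_nonneg_left hB hc0)
    have h2 : T * (x * ((b : ℝ) ^ (n / 2))⁻¹) ≤ C * x :=
      (mul_le_mul_of_nonneg_left hxn hT0).trans (h1.trans hC)
    rw [← div_le_iff₀ (by positivity), div_eq_mul_inv]
    refine le_of_mul_le_mul_right ?_ hx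
    linarith
  calc ∑ d ∈ degreeVectors n, ∏ j, (selfReciprocalBound ε q (d j) : ℝ)
      ≤ T * ((q : ℝ) / b) ^ (n / 2) := by
        rw [hT, Finset.sum_mul]
        exact Finset.sum_le_sum fun d hd => prod_selfReciprocalBound_le ε hb hbq hd
    _ ≤ C * (b : ℝ) ^ (n / 2) * ((q : ℝ) / b) ^ (n / 2) :=
        mul_le_mul_of_nonneg_right hTC (by positivity)
    _ = C * (q : ℝ) ^ (n / 2) := by
        rw [mul_assoc, ← mul_pow, mul_div_cancel₀ _ hb'.ne']

end Estimates

lemma natCard_quot_congRel_le_sum {F : Type} [Field F] [Fintype F] {ε : ℕ}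
    (hε : (ε = 0 ∧ (2 : F) = 0) ∨ (ε = 1 ∧ (2 : F) ≠ 0)) (n : ℕ) :
    Nat.card (Quot (congRel (n := n) (F := F))) ≤
      ∑ d ∈ degreeVectors n, ∏ j, selfReciprocalBound ε (Fintype.card F) (d j) := by
  obtain ⟨hfin, hcard⟩ := ncard_selfReciprocalTuples_le hε n
  exact (natCard_quot_congRel_le_ncard hfin).trans hcard

theorem stmt15 (q n : ℕ) (hq : IsPrimePow q) (hn : 1 ≤ n)
    (F : Type) [Field F] [Fintype F] (hF : Fintype.card F = q) :
    (q % 2 = 0 → Nat.card (Quot (congRel (n := n) (F := F))) ≤ 28 * q ^ (n / 2)) ∧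
    (q % 2 = 1 → Nat.card (Quot (congRel (n := n) (F := F))) ≤ 23 * q ^ (n / 2)) := by
  obtain ⟨m, rfl⟩ : ∃ m, n = m + 1 := ⟨n - 1, by omega⟩
  have hq1 := hq.one_lt
  constructor
  · intro heven
    have h2 : (2 : F) = 0 := by
      have := ringChar.of_eq (FiniteField.even_card_iff_char_two.mpr (hF ▸ heven))
      exact_mod_cast CharP.cast_eq_zero F 2
    refine (natCard_quot_congRel_le_sum (Or.inl ⟨rfl, h2⟩) (m + 1)).trans ?_
    obtain ⟨x, hx, hx2⟩ : ∃ x : ℝ, 0 < x ∧ x ^ 2 = 1 / 2 :=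
      ⟨√(1 / 2), by positivity, Real.sq_sqrt (by norm_num)⟩
    have h := sum_prod_selfReciprocalBound_le_mul_pow (q := q) (C := 28) two_pos hq1 hx
      (by nlinarith) (by rw [hx2]; norm_num) (selfReciprocalBound_zero_two_mul_pow_le hx hx2)
      (prod_genFun_two_le hx hx2 m) (by nlinarith)
    rw [hF]
    exact_mod_cast h
  · intro hodd
    have h2 : (2 : F) ≠ 0 := by
      refine Ring.two_ne_zero fun h => ?_
      have := FiniteField.even_card_iff_char_two.mp h
      omega
    refine (natCard_quot_congRel_le_sum (Or.inr ⟨rfl, h2⟩) (m + 1)).trans ?_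
    obtain ⟨x, hx, hx2⟩ : ∃ x : ℝ, 0 < x ∧ x ^ 2 = 1 / 3 :=
      ⟨√(1 / 3), by positivity, Real.sq_sqrt (by norm_num)⟩
    have h := sum_prod_selfReciprocalBound_le_mul_pow (q := q) (C := 23) three_pos
      (show 3 ≤ q by omega) hx (by nlinarith) (by rw [hx2]; norm_num)
      (selfReciprocalBound_one_three_mul_pow_le hx hx2)
      (prod_genFun_three_le hx hx2 m) (by nlinarith)
    rw [hF]
    exact_mod_cast h
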